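/- Let p ∈ (0,∞) and n ≥ 1. The L^p-Mahler integral of the convex quadratic q₂(x) := |x|²/2 on ℝⁿ equals M_p(q₂) = ( 2π·√((1+p)^{(1+p)/p}/p) )ⁿ. -/

import Mathlib

open MeasureTheory Real Filter
open scoped ENNReal RealInnerProductSpace Classical

noncomputable section

abbrev Euc (n : ℕ) : Type := EuclideanSpace ℝ (Fin n)

/-- `e^t` as an extended nonnegative real, for `t : EReal` (`e^{-∞}=0`, `e^{+∞}=∞`). -/
def erealExp (t : EReal) : ℝ≥0∞ :=
  if t = ⊥ then 0 else if t = ⊤ then ⊤ else ENNReal.ofReal (Real.exp t.toReal)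

/-- The volume `V(f) = ∫ e^{-f}` of `f : ℝⁿ → ℝ ∪ {+∞}`, as an extended nonnegative real. -/
def VolE {n : ℕ} (f : Euc n → EReal) : ℝ≥0∞ := ∫⁻ x, erealExp (-(f x))

/-- The volume `V(f) = ∫ e^{-f}` as a real number. -/
def Vol {n : ℕ} (f : Euc n → EReal) : ℝ := (VolE f).toReal

/-- `∫ e^{p⟨x,y⟩ - (p+1) f(x)} dx`. -/
def LpIntE {n : ℕ} (p : ℝ) (f : Euc n → EReal) (y : Euc n) : ℝ≥0∞ :=
  ∫⁻ x, erealExp (((p * ⟪x, y⟫ : ℝ) : EReal) - ((p + 1 : ℝ) : EReal) * f x)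

/-- The `L^p`-Legendre transform
`f^{*,p}(y) = (1/p) log ( ∫ e^{p⟨x,y⟩ - (p+1) f(x)} dx / V(f) )`,
with value `+∞` when the integral diverges. -/
def LpStar {n : ℕ} (p : ℝ) (f : Euc n → EReal) (y : Euc n) : EReal :=
  if LpIntE p f y = ⊤ then ⊤
  else (((1 / p) * Real.log ((LpIntE p f y).toReal / Vol f) : ℝ) : EReal)

/-- The `L^p`-Mahler integral `M_p(f) = V(f) · V(f^{*,p})`, as an extended nonnegative real. -/
def MpE {n : ℕ} (p : ℝ) (f : Euc n → EReal) : ℝ≥0∞ := VolE f * VolE (LpStar p f)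

/-- The translate `(T_a f)(x) = f(x + a)`. -/
def Transl {n : ℕ} (a : Euc n) (f : Euc n → EReal) : Euc n → EReal := fun x => f (x + a)

/-- Convexity of an `ℝ ∪ {+∞}`-valued function. -/
def ConvexE {n : ℕ} (φ : Euc n → EReal) : Prop :=
  ∀ x y : Euc n, ∀ l : ℝ, 0 ≤ l → l ≤ 1 →
    φ ((1 - l) • x + l • y) ≤ ((1 - l : ℝ) : EReal) * φ x + ((l : ℝ) : EReal) * φ y

/-- The class `Cvx(ℝⁿ)`: convex, lower semicontinuous functions `ℝⁿ → ℝ ∪ {+∞}`,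
not identically `+∞`, with `0 < V(φ) < ∞`. -/
structure InCvx {n : ℕ} (φ : Euc n → EReal) : Prop where
  noBot : ∀ x, φ x ≠ ⊥
  convex : ConvexE φ
  lsc : LowerSemicontinuous φ
  proper : ∃ x, φ x ≠ ⊤
  volPos : 0 < VolE φ
  volFin : VolE φ < ⊤

/-- The barycenter `b(g) = ∫ x e^{-g(x)} dx / V(g)`. -/
def bary {n : ℕ} (g : Euc n → EReal) : Euc n :=
  (Vol g)⁻¹ • ∫ x, (erealExp (-(g x))).toReal • x

/-- The classical Legendre transform `f^*(y) = sup_x (⟨x,y⟩ - f(x))`. -/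
def Lstar {n : ℕ} (f : Euc n → EReal) (y : Euc n) : EReal :=
  ⨆ x : Euc n, (((⟪x, y⟫ : ℝ) : EReal) - f x)



theorem erealExp_coe (t : ℝ) : erealExp (t : EReal) = ENNReal.ofReal (Real.exp t) := by
  simp [erealExp]

theorem gauss0 (n : ℕ) {b : ℝ} (hb : 0 < b) :
    ∫⁻ x : Euc n, ENNReal.ofReal (Real.exp (-b * ‖x‖ ^ 2)) =
      ENNReal.ofReal ((π / b) ^ ((n : ℝ) / 2)) := by
  have h := GaussianFourier.integral_rexp_neg_mul_sq_norm (V := Euc n) hb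
  have hpos : 0 < (π / b) ^ ((n : ℝ) / 2) := Real.rpow_pos_of_pos (div_pos Real.pi_pos hb) _
  rw [finrank_euclideanSpace_fin] at h
  rw [← h, ofReal_integral_eq_lintegral_ofReal]
  · by_contra hni
    rw [integral_undef hni] at h
    exact hpos.ne h
  · exact Eventually.of_forall fun x => (Real.exp_pos _).le

theorem gauss1 (n : ℕ) {b : ℝ} (hb : 0 < b) (c : ℝ) (y : Euc n) :
    ∫⁻ x : Euc n, ENNReal.ofReal (Real.exp (c * ⟪x, y⟫ - b * ‖x‖ ^ 2)) =
      ENNReal.ofReal ((π / b) ^ ((n : ℝ) / 2) * Real.exp (c ^ 2 * ‖y‖ ^ 2 / (4 * b))) := by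
  have h1 : ∀ x : Euc n, ENNReal.ofReal (Real.exp (c * ⟪x, y⟫ - b * ‖x‖ ^ 2)) =
      ENNReal.ofReal (Real.exp (-b * ‖x - (c / (2 * b)) • y‖ ^ 2)) *
        ENNReal.ofReal (Real.exp (c ^ 2 * ‖y‖ ^ 2 / (4 * b))) := by
    intro x
    rw [← ENNReal.ofReal_mul (Real.exp_pos _).le, ← Real.exp_add]
    congr 2
    rw [norm_sub_sq_real, inner_smul_right, norm_smul, mul_pow, Real.norm_eq_abs, sq_abs]
    field_simp
    ring
  simp_rw [h1]
  rw [lintegral_mul_const' _ _ ENNReal.ofReal_ne_top,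
    lintegral_sub_right_eq_self (fun x : Euc n => ENNReal.ofReal (Real.exp (-b * ‖x‖ ^ 2))),
    gauss0 n hb, ← ENNReal.ofReal_mul]
  positivity

/-- the `L^p`-Mahler integral of the convex quadratic `|x|²/2`:
`M_p(|x|²/2) = (2π √((1+p)^((1+p)/p)/p))ⁿ`. -/
theorem lp_mahler_quadratic (n : ℕ) (hn : 1 ≤ n) (p : ℝ) (hp : 0 < p) :
    MpE p (fun x : Euc n => ((‖x‖ ^ 2 / 2 : ℝ) : EReal)) =
      ENNReal.ofReal ((2 * π * Real.sqrt ((1 + p) ^ ((1 + p) / p) / p)) ^ n) := by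
  have hp1 : 0 < 1 + p := by linarith
  have hV : VolE (fun x : Euc n => ((‖x‖ ^ 2 / 2 : ℝ) : EReal)) =
      ENNReal.ofReal ((2 * π) ^ ((n : ℝ) / 2)) := by
    have h := gauss0 n (b := 1 / 2) (by norm_num)
    rw [show π / (1 / 2) = 2 * π by ring] at h
    rw [← h, VolE]
    refine lintegral_congr fun x => ?_
    rw [← EReal.coe_neg, erealExp_coe]
    congr 2
    ring
  have hI : ∀ y, LpIntE p (fun x : Euc n => ((‖x‖ ^ 2 / 2 : ℝ) : EReal)) y =
      ENNReal.ofReal ((2 * π / (1 + p)) ^ ((n : ℝ) / 2) *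
        Real.exp (p ^ 2 * ‖y‖ ^ 2 / (2 * (1 + p)))) := by
    intro y
    have h := gauss1 n (b := (1 + p) / 2) (by positivity) p y
    rw [show π / ((1 + p) / 2) = 2 * π / (1 + p) by field_simp,
      show 4 * ((1 + p) / 2) = 2 * (1 + p) by ring] at h
    rw [← h, LpIntE]
    refine lintegral_congr fun x => ?_
    rw [← EReal.coe_mul, ← EReal.coe_sub, erealExp_coe]
    congr 2
    ring
  have hS : ∀ y, LpStar p (fun x : Euc n => ((‖x‖ ^ 2 / 2 : ℝ) : EReal)) y =
      ((-((n : ℝ) / 2 / p * Real.log (1 + p)) + p / (2 * (1 + p)) * ‖y‖ ^ 2 : ℝ) : EReal) := by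
    intro y
    rw [LpStar, hI, if_neg ENNReal.ofReal_ne_top, Vol, hV, ENNReal.toReal_ofReal (by positivity),
      ENNReal.toReal_ofReal (by positivity)]
    congr 1
    rw [Real.div_rpow (by positivity) hp1.le]
    have h2 : (0 : ℝ) < (2 * π) ^ ((n : ℝ) / 2) := by positivity
    have h3 : (0 : ℝ) < (1 + p) ^ ((n : ℝ) / 2) := by positivity
    rw [show (2 * π) ^ ((n : ℝ) / 2) / (1 + p) ^ ((n : ℝ) / 2) *
        Real.exp (p ^ 2 * ‖y‖ ^ 2 / (2 * (1 + p))) / (2 * π) ^ ((n : ℝ) / 2) =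
        Real.exp (p ^ 2 * ‖y‖ ^ 2 / (2 * (1 + p))) / (1 + p) ^ ((n : ℝ) / 2) by field_simp,
      Real.log_div (Real.exp_pos _).ne' h3.ne', Real.log_exp, Real.log_rpow hp1]
    field_simp
    ring
  have hW : VolE (LpStar p (fun x : Euc n => ((‖x‖ ^ 2 / 2 : ℝ) : EReal))) =
      ENNReal.ofReal ((1 + p) ^ ((n : ℝ) / 2 / p) * (2 * π * (1 + p) / p) ^ ((n : ℝ) / 2)) := by
    have h := gauss0 n (b := p / (2 * (1 + p))) (by positivity)
    rw [show π / (p / (2 * (1 + p))) = 2 * π * (1 + p) / p by field_simp] at h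
    rw [ENNReal.ofReal_mul (by positivity), ← h, VolE,
      ← lintegral_const_mul' _ _ ENNReal.ofReal_ne_top]
    refine lintegral_congr fun x => ?_
    rw [hS, ← EReal.coe_neg, erealExp_coe, ← ENNReal.ofReal_mul (by positivity),
      Real.rpow_def_of_pos hp1, ← Real.exp_add]
    congr 2
    ring
  rw [MpE, hV, hW, ← ENNReal.ofReal_mul (by positivity)]
  congr 1
  have hpi : 0 < 2 * π := by positivity
  rw [← Real.rpow_natCast, Real.sqrt_eq_rpow, Real.mul_rpow hpi.le (by positivity),
    ← Real.rpow_mul (by positivity)]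
  obtain ⟨m, hm⟩ : ∃ m : ℝ, (n : ℝ) = m + m := ⟨(n : ℝ) / 2, by ring⟩
  rw [hm, show (m + m) / 2 = m by ring, show 1 / 2 * (m + m) = m by ring,
    Real.div_rpow (by positivity) hp.le, Real.div_rpow (by positivity) hp.le,
    ← Real.rpow_mul hp1.le, Real.mul_rpow hpi.le hp1.le,
    show (1 + p) / p * m = m / p + m by field_simp,
    Real.rpow_add hp1, Real.rpow_add hpi]
  ring

end
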